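/- arXiv:2301.11678 — 2 statements merged into one kernel-verified Lean document; each statement's English description precedes it below -/
import Mathlib

section
/- Let n, p ≥ 1, let C• and C̃ be symmetric p-tensors on ℝ^n, and let s ∈ ℝ^n be nonzero. Then there exists a unique symmetric p-tensor C+ minimizing ‖C − C•‖_F over all symmetric p-tensors C satisfying C[s] = C̃[s]. Moreover, C+ is the unique symmetric p-tensor such that the update U = C+ − C• satisfies both U[s] = (C̃ − C•)[s] and U[u_1,…,u_p] = 0 whenever u_1,…,u_p ∈ ℝ^n are all orthogonal to s. -/
open scoped BigOperators
open Matrix Filter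

noncomputable section

/-- A `q`-tensor on `ℝ^n` (a multilinear map `(ℝ^n)^q → ℝ`), represented by its
coefficient array on the standard basis. -/
abbrev Tensor (n q : ℕ) := (Fin q → Fin n) → ℝ

namespace Tensor

/-- Evaluation of a tensor (as a multilinear map) on the vectors `u 0, …, u (q-1)`. -/
def eval {n q : ℕ} (T : Tensor n q) (u : Fin q → (Fin n → ℝ)) : ℝ :=
  ∑ i : Fin q → Fin n, T i * ∏ k, u k (i k)

/-- A tensor is symmetric if it is invariant under all permutations of its arguments. -/
def Symm {n q : ℕ} (T : Tensor n q) : Prop :=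
  ∀ σ : Equiv.Perm (Fin q), ∀ i : Fin q → Fin n, T (i ∘ σ) = T i

/-- The Frobenius norm of a tensor: the Euclidean norm of its coefficient array. -/
def frobNorm {n q : ℕ} (T : Tensor n q) : ℝ :=
  Real.sqrt (∑ i : Fin q → Fin n, (T i) ^ 2)

/-- The Frobenius inner product of two tensors. -/
def finner {n q : ℕ} (T S : Tensor n q) : ℝ := ∑ i : Fin q → Fin n, T i * S i

/-- The symmetric projection `P_sym(T) = (1/q!) ∑_σ σ(T)`. -/
def psym {n q : ℕ} (T : Tensor n q) : Tensor n q :=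
  fun i => ((Nat.factorial q : ℝ))⁻¹ * ∑ σ : Equiv.Perm (Fin q), T (i ∘ σ)

/-- `T[W]^q`: apply the matrix `W` to every argument of `T`. -/
def applyMat {n q : ℕ} (T : Tensor n q) (W : Matrix (Fin n) (Fin n) ℝ) : Tensor n q :=
  fun j => ∑ i : Fin q → Fin n, T i * ∏ k, W (i k) (j k)

/-- `T[v]^j`: fix the first `j` arguments of `T` to the vector `v`,
yielding a `(q-j)`-tensor. -/
def fixMany {n q : ℕ} (T : Tensor n q) (v : Fin n → ℝ) (j : ℕ) : Tensor n (q - j) :=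
  fun idx => ∑ i : Fin j → Fin n, (∏ k, v (i k)) *
    T (fun k => if h : (k : ℕ) < j then i ⟨k, h⟩
        else idx ⟨(k : ℕ) - j, by have hk := k.isLt; omega⟩)

/-- The outer product of two tensors. -/
def outer {n a b : ℕ} (T : Tensor n a) (S : Tensor n b) : Tensor n (a + b) :=
  fun idx => T (fun k => idx (Fin.castAdd b k)) * S (fun k => idx (Fin.natAdd a k))

/-- Reindexing a tensor along an equality of orders. -/
def castOrder {n a b : ℕ} (h : a = b) (T : Tensor n a) : Tensor n b :=
  fun idx => T (fun k => idx (Fin.cast h k))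

/-- Apply a matrix to the first argument of a tensor only. -/
def applyFirst {n q : ℕ} (hq : 0 < q) (T : Tensor n q) (M : Matrix (Fin n) (Fin n) ℝ) :
    Tensor n q :=
  fun idx => ∑ i : Fin n, M i (idx ⟨0, hq⟩) * T (Function.update idx ⟨0, hq⟩ i)

end Tensor

/-- `⊗^j v`, the `j`-fold outer product of a vector `v` with itself. -/
def vpow {n : ℕ} (j : ℕ) (v : Fin n → ℝ) : Tensor n j := fun idx => ∏ k, v (idx k)

/-- The Euclidean (2-) norm of a vector in `ℝ^n`. -/
def vnorm {n : ℕ} (v : Fin n → ℝ) : ℝ := Real.sqrt (∑ i, v i ^ 2)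

/-- The injective (2-) norm of a tensor:
the supremum of `|T[u_1,…,u_q]|` over unit vectors. -/
def Tensor.inj2Norm {n q : ℕ} (T : Tensor n q) : ℝ :=
  sSup ((fun u => |T.eval u|) '' {u : Fin q → Fin n → ℝ | ∀ k, vnorm (u k) = 1})

/-- The spectral (operator 2-) norm of a matrix. -/
def specNorm {n : ℕ} (M : Matrix (Fin n) (Fin n) ℝ) : ℝ :=
  ‖Matrix.toEuclideanCLM (𝕜 := ℝ) M‖

/-- The orthogonal projection `I - w wᵀ / (wᵀ w)` onto the orthogonal complement of `w`. -/
def projPerp {n : ℕ} (w : Fin n → ℝ) : Matrix (Fin n) (Fin n) ℝ :=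
  1 - (w ⬝ᵥ w)⁻¹ • Matrix.vecMulVec w w

/-- `Cp` is a least-change symmetric update of `Cb` in the `W`-weighted Frobenius norm,
subject to the secant equation `Cp[s] = R`. -/
def IsSecantUpdate {n p : ℕ} (Cb : Tensor n p) (R : Tensor n (p - 1))
    (W : Matrix (Fin n) (Fin n) ℝ) (s : Fin n → ℝ) (Cp : Tensor n p) : Prop :=
  Cp.Symm ∧ Cp.fixMany s 1 = R ∧
    ∀ C : Tensor n p, C.Symm → C.fixMany s 1 = R →
      ((Cp - Cb).applyMat W).frobNorm ≤ ((C - Cb).applyMat W).frobNorm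

/-- The explicit higher-order secant update formula of Theorem 1 (b):
`C• + ∑_{j=1}^p (-1)^{j+1} C(p,j) (vᵀs)^{-j} P_sym((⊗^j v) ⊗ (C̃ - C•)[s]^j)`. -/
def hosuFormula {n p : ℕ} (Cb Ct : Tensor n p) (v s : Fin n → ℝ) : Tensor n p :=
  Cb + ∑ j ∈ (Finset.Icc 1 p).attach,
    ((-1 : ℝ) ^ ((j : ℕ) + 1) * (p.choose (j : ℕ) : ℝ) * ((v ⬝ᵥ s) ^ (j : ℕ))⁻¹) •
      Tensor.castOrder (Nat.add_sub_cancel' (Finset.mem_Icc.mp j.2).2)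
        (Tensor.psym ((vpow (j : ℕ) v).outer ((Ct - Cb).fixMany s (j : ℕ))))

/-- The coefficient array of the `q`-th derivative of `f : ℝ^n → ℝ`
(domain given the sup-norm product structure). -/
def derivTensorPi {n : ℕ} (q : ℕ) (f : (Fin n → ℝ) → ℝ) (x : Fin n → ℝ) : Tensor n q :=
  fun idx => iteratedFDeriv ℝ q f x (fun k => Pi.single (idx k) 1)

/-- The coefficient array of the `q`-th derivative of `f : ℝ^n → ℝ`
(domain given the Euclidean structure). -/
def derivTensorE {n : ℕ} (q : ℕ) (f : EuclideanSpace ℝ (Fin n) → ℝ)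
    (x : EuclideanSpace ℝ (Fin n)) : Tensor n q :=
  fun idx => iteratedFDeriv ℝ q f x (fun k => EuclideanSpace.single (idx k) 1)

/-- Reinterpret a Euclidean vector as a plain vector in `Fin n → ℝ`. -/
def toVec {n : ℕ} (y : EuclideanSpace ℝ (Fin n)) : Fin n → ℝ := y

namespace Tensor

variable {n p q : ℕ}

/-- Evaluation of a tensor, bundled as a multilinear map. -/
def evalMultilinear (T : Tensor n q) : MultilinearMap ℝ (fun _ : Fin q => Fin n → ℝ) ℝ :=
  ∑ i : Fin q → Fin n,
    T i • (MultilinearMap.mkPiAlgebra ℝ (Fin q) ℝ).compLinearMap fun k => LinearMap.proj (i k)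

theorem evalMultilinear_apply (T : Tensor n q) (u : Fin q → Fin n → ℝ) :
    T.evalMultilinear u = T.eval u := by
  simp [evalMultilinear, eval]

theorem eval_sub (T S : Tensor n q) (u : Fin q → Fin n → ℝ) :
    (T - S).eval u = T.eval u - S.eval u := by
  simp [eval, sub_mul]

theorem eval_single (T : Tensor n q) (j : Fin q → Fin n) :
    T.eval (fun k => Pi.single (j k) 1) = T j := by
  unfold eval
  rw [Finset.sum_eq_single j]
  · simp
  · intro i _ hij
    obtain ⟨k, hk⟩ := Function.ne_iff.mp hij
    rw [Finset.prod_eq_zero (Finset.mem_univ k), mul_zero]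
    simp [hk]
  · simp

theorem eval_applyMat (T : Tensor n q) (W : Matrix (Fin n) (Fin n) ℝ)
    (u : Fin q → Fin n → ℝ) :
    (T.applyMat W).eval u = T.eval fun k => W *ᵥ u k := by
  have h (i : Fin q → Fin n) : ∏ k, (W *ᵥ u k) (i k)
      = ∑ j : Fin q → Fin n, ∏ k, W (i k) (j k) * u k (j k) := by
    simp only [Matrix.mulVec, dotProduct]
    rw [Finset.prod_univ_sum, Fintype.piFinset_univ]
  simp only [eval, applyMat, h, Finset.sum_mul, Finset.mul_sum]
  rw [Finset.sum_comm]
  simp only [Finset.prod_mul_distrib, mul_assoc]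

theorem Symm.sub {T S : Tensor n q} (hT : T.Symm) (hS : S.Symm) : (T - S).Symm :=
  fun σ i => by simp [hT σ i, hS σ i]

theorem Symm.eval_comp {T : Tensor n q} (hT : T.Symm) (σ : Equiv.Perm (Fin q))
    (u : Fin q → Fin n → ℝ) : T.eval (u ∘ σ) = T.eval u := by
  unfold eval
  refine Fintype.sum_equiv (σ.symm.arrowCongr (Equiv.refl _)).symm _ _ fun i => ?_
  have h : ((σ.symm.arrowCongr (Equiv.refl (Fin n))).symm i) = i ∘ σ.symm := rfl
  rw [h, hT σ.symm i]
  congr 1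
  exact Fintype.prod_equiv σ _ _ fun k => by simp

theorem Symm.applyMat {T : Tensor n q} (hT : T.Symm) (W : Matrix (Fin n) (Fin n) ℝ) :
    (T.applyMat W).Symm :=
  fun σ j => hT.eval_comp σ fun k a => W a (j k)

theorem fixMany_one_apply (T : Tensor n (q + 1)) (s : Fin n → ℝ) (idx : Fin q → Fin n) :
    T.fixMany s 1 idx = ∑ a, s a * T (Fin.cons a idx) := by
  unfold fixMany
  refine Fintype.sum_equiv (Equiv.funUnique (Fin 1) (Fin n)) _ _ fun i => ?_
  have h : (fun k : Fin (q + 1) => if h : (k : ℕ) < 1 then i ⟨k, h⟩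
        else idx ⟨(k : ℕ) - 1, by have hk := k.isLt; omega⟩) = Fin.cons (i 0) idx := by
    funext k
    refine Fin.cases ?_ (fun k => ?_) k <;> simp
  simp only [Finset.univ_unique, Finset.prod_singleton]
  exact congrArg (fun x => s (i 0) * T x) h

theorem eval_cons (T : Tensor n (q + 1)) (s : Fin n → ℝ) (u : Fin q → Fin n → ℝ) :
    T.eval (Fin.cons s u : Fin (q + 1) → Fin n → ℝ) = eval (q := q) (T.fixMany s 1) u := by
  unfold eval
  simp only [fixMany_one_apply, Finset.sum_mul]
  rw [← (Fin.consEquiv fun _ : Fin (q + 1) => Fin n).sum_comp, Fintype.sum_prod_type_right]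
  refine Finset.sum_congr rfl fun i _ => Finset.sum_congr rfl fun a _ => ?_
  simp [Fin.consEquiv, Fin.prod_univ_succ]
  ring

theorem fixMany_sub (T S : Tensor n p) (s : Fin n → ℝ) (j : ℕ) :
    (T - S).fixMany s j = T.fixMany s j - S.fixMany s j := by
  funext idx
  simp [fixMany, mul_sub]

theorem fixMany_one_applyMat_eq_zero (T : Tensor n (q + 1)) {W : Matrix (Fin n) (Fin n) ℝ}
    {s : Fin n → ℝ} (h : W *ᵥ s = 0) : (T.applyMat W).fixMany s 1 = 0 := by
  funext idx
  refine (eval_single (q := q) ((T.applyMat W).fixMany s 1) idx).symm.trans ?_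
  rw [← eval_cons, eval_applyMat, ← evalMultilinear_apply]
  exact MultilinearMap.map_coord_zero _ 0 (by simpa using h)

theorem Symm.eval_eq_zero {T : Tensor n (q + 1)} (hT : T.Symm) {s : Fin n → ℝ}
    (h : T.fixMany s 1 = 0) {u : Fin (q + 1) → Fin n → ℝ} {k : Fin (q + 1)} (hk : u k = s) :
    T.eval u = 0 := by
  rw [← hT.eval_comp (Equiv.swap 0 k) u, ← Fin.cons_self_tail (u ∘ Equiv.swap 0 k)]
  simp only [Function.comp_apply, Equiv.swap_apply_left, hk]
  rw [eval_cons, h]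
  simp [eval]

/-- A symmetric tensor annihilated by `s` does not see the components of its arguments
along `s`. -/
theorem Symm.eval_sub_smul {T : Tensor n (q + 1)} (hT : T.Symm) {s : Fin n → ℝ}
    (h : T.fixMany s 1 = 0) (u : Fin (q + 1) → Fin n → ℝ) (c : Fin (q + 1) → ℝ) :
    T.eval (fun k => u k - c k • s) = T.eval u := by
  have key (A : Finset (Fin (q + 1))) :
      T.eval (fun k => if k ∈ A then u k - c k • s else u k) = T.eval u := by
    induction A using Finset.induction_on with
    | empty => simp
    | insert a A ha ih =>
      set v : Fin (q + 1) → Fin n → ℝ := fun k => if k ∈ A then u k - c k • s else u k with hv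
      have hins : (fun k => if k ∈ insert a A then u k - c k • s else u k)
          = Function.update v a (u a - c a • s) := by
        funext k
        by_cases hk : k = a
        · subst hk; simp
        · simp [hk, hv]
      have hva : Function.update v a (u a) = v := by
        rw [Function.update_eq_self_iff]; simp [hv, ha]
      rw [hins, ← evalMultilinear_apply, MultilinearMap.map_update_sub,
        MultilinearMap.map_update_smul, hva, evalMultilinear_apply, evalMultilinear_apply,
        hT.eval_eq_zero h (Function.update_self a s v), ih]
      simp
  simpa using key Finset.univ

end Tensor

section projPerp

variable {n : ℕ}

theorem projPerp_mulVec (s v : Fin n → ℝ) :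
    projPerp s *ᵥ v = v - ((s ⬝ᵥ s)⁻¹ * (s ⬝ᵥ v)) • s := by
  simp [projPerp, Matrix.sub_mulVec, Matrix.smul_mulVec, Matrix.vecMulVec_mulVec, smul_smul]

theorem projPerp_mulVec_self {s : Fin n → ℝ} (hs : s ≠ 0) : projPerp s *ᵥ s = 0 := by
  have h : s ⬝ᵥ s ≠ 0 := by simpa using hs
  rw [projPerp_mulVec, inv_mul_cancel₀ h, one_smul, sub_self]

theorem projPerp_mulVec_of_dotProduct_eq_zero {s v : Fin n → ℝ} (h : v ⬝ᵥ s = 0) :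
    projPerp s *ᵥ v = v := by
  rw [projPerp_mulVec, dotProduct_comm s v, h, mul_zero, zero_smul, sub_zero]

theorem projPerp_transpose (s : Fin n → ℝ) : (projPerp s)ᵀ = projPerp s := by
  simp [projPerp, Matrix.transpose_sub, Matrix.transpose_smul, Matrix.transpose_vecMulVec]

theorem projPerp_mulVec_dotProduct {s : Fin n → ℝ} (hs : s ≠ 0) (v : Fin n → ℝ) :
    (projPerp s *ᵥ v) ⬝ᵥ s = 0 := by
  rw [dotProduct_comm, Matrix.dotProduct_mulVec, ← Matrix.mulVec_transpose, projPerp_transpose,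
    projPerp_mulVec_self hs, zero_dotProduct]

end projPerp

namespace Tensor

variable {n q : ℕ}

theorem applyMat_apply_eq_eval (T : Tensor n q) (W : Matrix (Fin n) (Fin n) ℝ)
    (j : Fin q → Fin n) : T.applyMat W j = T.eval fun k => W *ᵥ Pi.single (j k) 1 := by
  rw [← eval_applyMat, eval_single]

theorem Symm.applyMat_projPerp {T : Tensor n (q + 1)} (hT : T.Symm) {s : Fin n → ℝ}
    (h : T.fixMany s 1 = 0) : T.applyMat (projPerp s) = T := by
  funext j
  rw [applyMat_apply_eq_eval]
  simp only [projPerp_mulVec]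
  rw [hT.eval_sub_smul h, eval_single]

theorem finner_applyMat (T S : Tensor n q) (W : Matrix (Fin n) (Fin n) ℝ) :
    (T.applyMat W).finner S = T.finner (S.applyMat Wᵀ) := by
  simp only [finner, applyMat, Finset.sum_mul, Finset.mul_sum, Matrix.transpose_apply]
  rw [Finset.sum_comm]
  refine Finset.sum_congr rfl fun i _ => Finset.sum_congr rfl fun j _ => ?_
  ring

theorem frobNorm_nonneg (T : Tensor n q) : 0 ≤ T.frobNorm := Real.sqrt_nonneg _

theorem frobNorm_sq (T : Tensor n q) : T.frobNorm ^ 2 = ∑ i, T i ^ 2 :=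
  Real.sq_sqrt (Finset.sum_nonneg fun _ _ => sq_nonneg _)

theorem frobNorm_eq_zero {T : Tensor n q} (h : T.frobNorm = 0) : T = 0 := by
  have h2 := T.frobNorm_sq
  rw [h, zero_pow two_ne_zero, eq_comm,
    Finset.sum_eq_zero_iff_of_nonneg fun _ _ => sq_nonneg _] at h2
  funext i
  simpa using h2 i (Finset.mem_univ i)

theorem frobNorm_add_sq {T S : Tensor n q} (h : T.finner S = 0) :
    (T + S).frobNorm ^ 2 = T.frobNorm ^ 2 + S.frobNorm ^ 2 := by
  have : ∑ i, (T + S) i ^ 2 = ∑ i, T i ^ 2 + ∑ i, S i ^ 2 + 2 * T.finner S := by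
    simp only [finner, Finset.mul_sum, ← Finset.sum_add_distrib, Pi.add_apply]
    exact Finset.sum_congr rfl fun i _ => by ring
  simp only [frobNorm_sq, this, h, mul_zero, add_zero]

end Tensor

/-- existence and uniqueness of the least-change symmetric update
(unweighted Frobenius norm), together with its characterization via the secant
equation and vanishing on vectors orthogonal to `s`. -/
theorem statement0 (n p : ℕ) (hn : 1 ≤ n) (hp : 1 ≤ p)
    (Cb Ct : Tensor n p) (hCb : Cb.Symm) (hCt : Ct.Symm)
    (s : Fin n → ℝ) (hs : s ≠ 0) :
    ∃ Cp : Tensor n p,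
      ((Cp.Symm ∧ Cp.fixMany s 1 = Ct.fixMany s 1 ∧
          ∀ C : Tensor n p, C.Symm → C.fixMany s 1 = Ct.fixMany s 1 →
            (Cp - Cb).frobNorm ≤ (C - Cb).frobNorm) ∧
        ∀ C : Tensor n p,
          (C.Symm ∧ C.fixMany s 1 = Ct.fixMany s 1 ∧
            ∀ C' : Tensor n p, C'.Symm → C'.fixMany s 1 = Ct.fixMany s 1 →
              (C - Cb).frobNorm ≤ (C' - Cb).frobNorm) → C = Cp) ∧
      ((Cp.Symm ∧ (Cp - Cb).fixMany s 1 = (Ct - Cb).fixMany s 1 ∧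
          ∀ u : Fin p → (Fin n → ℝ), (∀ k, u k ⬝ᵥ s = 0) → (Cp - Cb).eval u = 0) ∧
        ∀ C : Tensor n p,
          (C.Symm ∧ (C - Cb).fixMany s 1 = (Ct - Cb).fixMany s 1 ∧
            ∀ u : Fin p → (Fin n → ℝ), (∀ k, u k ⬝ᵥ s = 0) → (C - Cb).eval u = 0) →
          C = Cp) := by
  obtain ⟨q, rfl⟩ : ∃ q, p = q + 1 := ⟨p - 1, by omega⟩
  set D : Tensor n (q + 1) := Ct - Cb with hD
  have hDs : D.Symm := hCt.sub hCb
  set Cp : Tensor n (q + 1) := Ct - D.applyMat (projPerp s) with hCp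
  have hU : Cp - Cb = D - D.applyMat (projPerp s) := by rw [hCp, hD]; abel
  have hCpS : Cp.Symm := hCt.sub (hDs.applyMat _)
  have hCps : Cp.fixMany s 1 = Ct.fixMany s 1 := by
    rw [hCp, Tensor.fixMany_sub,
      Tensor.fixMany_one_applyMat_eq_zero _ (projPerp_mulVec_self hs), sub_zero]
  have hpyth : ∀ C : Tensor n (q + 1), C.Symm → C.fixMany s 1 = Ct.fixMany s 1 →
      (C - Cb).frobNorm ^ 2 = (Cp - Cb).frobNorm ^ 2 + (C - Cp).frobNorm ^ 2 := by
    intro C hC hCs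
    have hE : (C - Cp).applyMat (projPerp s) = C - Cp :=
      (hC.sub hCpS).applyMat_projPerp (by rw [Tensor.fixMany_sub, hCs, hCps, sub_self])
    have horth : (Cp - Cb).finner (C - Cp) = 0 := by
      have h := D.finner_applyMat (C - Cp) (projPerp s)
      rw [projPerp_transpose, hE] at h
      have hsub : (Cp - Cb).finner (C - Cp)
          = D.finner (C - Cp) - (D.applyMat (projPerp s)).finner (C - Cp) := by
        rw [hU]
        simp only [Tensor.finner, ← Finset.sum_sub_distrib]
        exact Finset.sum_congr rfl fun i _ => by simp only [Pi.sub_apply]; ring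
      rw [hsub, h, sub_self]
    rw [← Tensor.frobNorm_add_sq horth, add_comm (Cp - Cb), sub_add_sub_cancel]
  have hPu : ∀ u : Fin (q + 1) → Fin n → ℝ, (∀ k, u k ⬝ᵥ s = 0) → (Cp - Cb).eval u = 0 := by
    intro u hu
    rw [hU, Tensor.eval_sub, Tensor.eval_applyMat]
    simp only [projPerp_mulVec_of_dotProduct_eq_zero (hu _), sub_self]
  refine ⟨Cp, ⟨⟨hCpS, hCps, fun C hC hCs => ?_⟩, fun C ⟨hC, hCs, hmin⟩ => ?_⟩,
    ⟨hCpS, ?_, hPu⟩, fun C ⟨hC, hCs, hCu⟩ => ?_⟩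
  · refine le_of_sq_le_sq ?_ (Tensor.frobNorm_nonneg _)
    rw [hpyth C hC hCs]
    exact le_add_of_nonneg_right (sq_nonneg _)
  · have h1 := pow_le_pow_left₀ (Tensor.frobNorm_nonneg _) (hmin Cp hCpS hCps) 2
    have h2 := hpyth C hC hCs
    have h3 : (C - Cp).frobNorm ^ 2 = 0 := le_antisymm (by linarith) (sq_nonneg _)
    exact sub_eq_zero.mp (Tensor.frobNorm_eq_zero (pow_eq_zero_iff two_ne_zero |>.mp h3))
  · rw [Tensor.fixMany_sub, hCps, hD, Tensor.fixMany_sub]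
  · have hCs' : C.fixMany s 1 = Ct.fixMany s 1 := by
      rw [hD, Tensor.fixMany_sub, Tensor.fixMany_sub] at hCs
      exact sub_left_injective hCs
    have hE : (C - Cp).applyMat (projPerp s) = C - Cp :=
      (hC.sub hCpS).applyMat_projPerp (by rw [Tensor.fixMany_sub, hCs', hCps, sub_self])
    rw [← sub_eq_zero, ← hE]
    funext j
    have hj := fun k => projPerp_mulVec_dotProduct hs (Pi.single (j k) 1)
    rw [Tensor.applyMat_apply_eq_eval, ← sub_sub_sub_cancel_right C Cp Cb, Tensor.eval_sub,
      hCu _ hj, hPu _ hj, sub_zero, Pi.zero_apply]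
end
end

section
/- Let (W_k) be a sequence of nonsingular matrices in ℝ^{n×n} converging to the identity matrix I, and let (s_k) be any sequence of nonzero vectors in ℝ^n. Define P_k = I − (W_k^{-1}s_k s_k^T W_k^{-T})/(s_k^T W_k^{-T} W_k^{-1} s_k) and P_k^* = I − (s_k s_k^T)/(s_k^T s_k). Then ‖P_k − P_k^*‖_2 → 0 as k → ∞. -/
open scoped BigOperators
open Matrix Filter

noncomputable section

theorem projPerp_smul {n : ℕ} {c : ℝ} (hc : c ≠ 0) (w : Fin n → ℝ) :
    projPerp (c • w) = projPerp w := by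
  ext i j
  simp only [projPerp, smul_dotProduct, dotProduct_smul, Matrix.sub_apply, Matrix.smul_apply,
    Matrix.vecMulVec_apply, Pi.smul_apply, smul_eq_mul, mul_inv]
  field_simp

theorem continuousAt_projPerp {n : ℕ} {w : Fin n → ℝ} (hw : w ≠ 0) :
    ContinuousAt projPerp w := by
  have hdot : w ⬝ᵥ w ≠ 0 := fun h => hw (dotProduct_self_eq_zero.mp h)
  have hinv : ContinuousAt (fun v : Fin n → ℝ => (v ⬝ᵥ v)⁻¹) w :=
    (Continuous.dotProduct continuous_id continuous_id).continuousAt.inv₀ hdot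
  exact continuousAt_const.sub
    (hinv.smul (Continuous.matrix_vecMulVec continuous_id continuous_id).continuousAt)

theorem continuous_specNorm {n : ℕ} : Continuous (specNorm (n := n)) :=
  (LinearMap.continuous_of_finiteDimensional
    (Matrix.toEuclideanCLM (n := Fin n) (𝕜 := ℝ)).toAlgEquiv.toLinearMap).norm

/-- The projections for `A⁻¹ u` and `u` are close when `A` is close to `1`, locally uniformly
in `u ≠ 0`. -/
theorem tendsto_specNorm_projPerp_sub {n : ℕ} {u : Fin n → ℝ} (hu : u ≠ 0) :
    Tendsto (fun z : Matrix (Fin n) (Fin n) ℝ × (Fin n → ℝ) =>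
      specNorm (projPerp (z.1⁻¹ *ᵥ z.2) - projPerp z.2)) (nhds (1, u)) (nhds 0) := by
  have hinv : ContinuousAt (fun A : Matrix (Fin n) (Fin n) ℝ => A⁻¹) 1 :=
    continuousAt_matrix_inv _ (by simp)
  have hmul : ContinuousAt (fun z : Matrix (Fin n) (Fin n) ℝ × (Fin n → ℝ) => z.1⁻¹ *ᵥ z.2)
      (1, u) :=
    ContinuousAt.comp
      (g := fun z : Matrix (Fin n) (Fin n) ℝ × (Fin n → ℝ) => z.1 *ᵥ z.2)
      (f := fun z : Matrix (Fin n) (Fin n) ℝ × (Fin n → ℝ) => (z.1⁻¹, z.2))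
      (continuous_fst.matrix_mulVec continuous_snd).continuousAt
      ((ContinuousAt.comp (x := ((1 : Matrix (Fin n) (Fin n) ℝ), u)) hinv continuousAt_fst).prodMk
        continuousAt_snd)
  have hsub := (ContinuousAt.comp
      (f := fun z : Matrix (Fin n) (Fin n) ℝ × (Fin n → ℝ) => z.1⁻¹ *ᵥ z.2)
      (continuousAt_projPerp (by simpa using hu)) hmul).sub
    (ContinuousAt.comp (x := ((1 : Matrix (Fin n) (Fin n) ℝ), u))
      (continuousAt_projPerp hu) continuousAt_snd)
  have h := (continuous_specNorm.continuousAt.comp hsub).tendsto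
  simpa [Function.comp_def, specNorm] using h

/-- if `W_k → I`, then `‖P_k - P_k^*‖₂ → 0`, where `P_k` and `P_k^*` are
the orthogonal projections onto the complements of `W_k⁻¹ s_k` and `s_k`. -/
theorem statement11 (n : ℕ)
    (W : ℕ → Matrix (Fin n) (Fin n) ℝ) (hW : ∀ k, IsUnit (W k).det)
    (hWlim : Tendsto W atTop (nhds 1))
    (s : ℕ → (Fin n → ℝ)) (hs : ∀ k, s k ≠ 0) :
    Tendsto (fun k => specNorm (projPerp ((W k)⁻¹ *ᵥ s k) - projPerp (s k)))
      atTop (nhds 0) := by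
  refine Metric.tendsto_nhds.mpr fun ε hε => ?_
  have hunif := (isCompact_sphere (0 : Fin n → ℝ) 1).eventually_forall_of_forall_eventually
    (x₀ := (1 : Matrix (Fin n) (Fin n) ℝ))
    (P := fun A u => dist (specNorm (projPerp (A⁻¹ *ᵥ u) - projPerp u)) 0 < ε)
    fun u hu => Metric.tendsto_nhds.mp
      (tendsto_specNorm_projPerp_sub (ne_zero_of_mem_unit_sphere ⟨u, hu⟩)) ε hε
  filter_upwards [hWlim.eventually hunif] with k hk
  have hc : ‖s k‖⁻¹ ≠ 0 := inv_ne_zero (norm_ne_zero_iff.mpr (hs k))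
  have hunit : ‖s k‖⁻¹ • s k ∈ Metric.sphere (0 : Fin n → ℝ) 1 := by
    simpa using norm_smul_inv_norm (𝕜 := ℝ) (hs k)
  simpa only [Matrix.mulVec_smul, projPerp_smul hc] using hk _ hunit
end
end
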